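/- With α and β the standard SO(4)-forms on ℝ^7 as above, and with Λ²(ℝ^7)^* acting on ℝ^7 via (ω, v) ↦ v ⌟ ω (identifying 2-forms with skew-symmetric endomorphisms), each of the six 2-forms ϖ₁=e^{12}+e^{34}, ϖ₂=e^{13}+e^{42}, ϖ₃=e^{14}+e^{23}, ω₁−2w^{23}, ω₂−2w^{31}, ω₃−2w^{12} annihilates both α and β under the induced derivation action on forms. -/

import Mathlib

/- STATEMENT 1: each of the six 2-forms ϖ₁, ϖ₂, ϖ₃, ω₁−2w^{23}, ω₂−2w^{31}, ω₃−2w^{12},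
   acting as a skew-symmetric endomorphism of ℝ^7 via v ↦ v⌟ω, annihilates both α and β
   under the induced derivation action on forms. -/

noncomputable section

open scoped BigOperators

/-- The basic `k`-form `e^{l 0} ∧ ⋯ ∧ e^{l (k-1)}` on `ℝ^7`, as an alternating map. -/
def eform {k : ℕ} (l : Fin k → Fin 7) : AlternatingMap ℝ (Fin 7 → ℝ) ℝ (Fin k) :=
  (Matrix.detRowAlternating : AlternatingMap ℝ (Fin k → ℝ) ℝ (Fin k)).compLinearMap
    (LinearMap.funLeft ℝ ℝ l)

/-- The skew-symmetric endomorphism `A_ω` of `ℝ^7` associated to a 2-form `ω` by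
`⟨A_ω v, u⟩ = ω (v, u)`, i.e. `A_ω v = v ⌟ ω` with the index raised by the standard metric. -/
def twoFormEnd (ω : AlternatingMap ℝ (Fin 7 → ℝ) ℝ (Fin 2)) :
    (Fin 7 → ℝ) →ₗ[ℝ] (Fin 7 → ℝ) :=
  Matrix.toLin' (Matrix.of fun i j => ω ![Pi.single j 1, Pi.single i 1])

/-- `α` (0-based indices; `w^s = e^{4+s}` is the index `3+s`). -/
def α : AlternatingMap ℝ (Fin 7 → ℝ) ℝ (Fin 3) :=
  eform ![0,1,4] - eform ![2,3,4] + eform ![0,2,5] - eform ![3,1,5]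
    + eform ![0,3,6] - eform ![1,2,6] - (3:ℝ) • eform ![4,5,6]

def β : AlternatingMap ℝ (Fin 7 → ℝ) ℝ (Fin 4) :=
  -eform ![0,1,5,6] + eform ![2,3,5,6] - eform ![0,2,6,4] + eform ![3,1,6,4]
    - eform ![0,3,4,5] + eform ![1,2,4,5] - (3:ℝ) • eform ![0,1,2,3]

def ϖ₁ : AlternatingMap ℝ (Fin 7 → ℝ) ℝ (Fin 2) := eform ![0,1] + eform ![2,3]
def ϖ₂ : AlternatingMap ℝ (Fin 7 → ℝ) ℝ (Fin 2) := eform ![0,2] + eform ![3,1]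
def ϖ₃ : AlternatingMap ℝ (Fin 7 → ℝ) ℝ (Fin 2) := eform ![0,3] + eform ![1,2]
def κ₁ : AlternatingMap ℝ (Fin 7 → ℝ) ℝ (Fin 2) :=
  eform ![0,1] - eform ![2,3] - (2:ℝ) • eform ![5,6]
def κ₂ : AlternatingMap ℝ (Fin 7 → ℝ) ℝ (Fin 2) :=
  eform ![0,2] - eform ![3,1] - (2:ℝ) • eform ![6,4]
def κ₃ : AlternatingMap ℝ (Fin 7 → ℝ) ℝ (Fin 2) :=
  eform ![0,3] - eform ![1,2] - (2:ℝ) • eform ![4,5]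

theorem eform_two (l : Fin 2 → Fin 7) (v : Fin 2 → Fin 7 → ℝ) :
    eform l v = v 0 (l 0) * v 1 (l 1) - v 0 (l 1) * v 1 (l 0) :=
  Matrix.det_fin_two (Matrix.of fun i j => v i (l j))

theorem eform_three (l : Fin 3 → Fin 7) (v : Fin 3 → Fin 7 → ℝ) :
    eform l v = v 0 (l 0) * v 1 (l 1) * v 2 (l 2) - v 0 (l 0) * v 1 (l 2) * v 2 (l 1)
      - v 0 (l 1) * v 1 (l 0) * v 2 (l 2) + v 0 (l 1) * v 1 (l 2) * v 2 (l 0)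
      + v 0 (l 2) * v 1 (l 0) * v 2 (l 1) - v 0 (l 2) * v 1 (l 1) * v 2 (l 0) :=
  Matrix.det_fin_three (Matrix.of fun i j => v i (l j))

theorem eform_four (l : Fin 4 → Fin 7) (v : Fin 4 → Fin 7 → ℝ) :
    eform l v =
      (v 0 (l 0) * v 1 (l 1) - v 0 (l 1) * v 1 (l 0)) * (v 2 (l 2) * v 3 (l 3) - v 2 (l 3) * v 3 (l 2))
      - (v 0 (l 0) * v 1 (l 2) - v 0 (l 2) * v 1 (l 0)) * (v 2 (l 1) * v 3 (l 3) - v 2 (l 3) * v 3 (l 1))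
      + (v 0 (l 0) * v 1 (l 3) - v 0 (l 3) * v 1 (l 0)) * (v 2 (l 1) * v 3 (l 2) - v 2 (l 2) * v 3 (l 1))
      + (v 0 (l 1) * v 1 (l 2) - v 0 (l 2) * v 1 (l 1)) * (v 2 (l 0) * v 3 (l 3) - v 2 (l 3) * v 3 (l 0))
      - (v 0 (l 1) * v 1 (l 3) - v 0 (l 3) * v 1 (l 1)) * (v 2 (l 0) * v 3 (l 2) - v 2 (l 2) * v 3 (l 0))
      + (v 0 (l 2) * v 1 (l 3) - v 0 (l 3) * v 1 (l 2)) * (v 2 (l 0) * v 3 (l 1) - v 2 (l 1) * v 3 (l 0)) := by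
  change Matrix.det (Matrix.of fun i j => v i (l j)) = _
  rw [Matrix.det_succ_row_zero]
  simp [Fin.sum_univ_succ, Matrix.det_fin_three, Fin.succAbove]
  ring

/-- An alternating 3-form with one argument replaced, written out. -/
theorem sum_upd3 (φ : AlternatingMap ℝ (Fin 7 → ℝ) ℝ (Fin 3)) (A : (Fin 7 → ℝ) →ₗ[ℝ] (Fin 7 → ℝ))
    (v : Fin 3 → Fin 7 → ℝ) :
    -∑ i, φ (Function.update v i (A (v i))) = -(φ ![A (v 0), v 1, v 2] + φ ![v 0, A (v 1), v 2]
      + φ ![v 0, v 1, A (v 2)]) := by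
  rw [Fin.sum_univ_three]
  congr 4 <;> congr 1 <;> ext i : 1 <;> fin_cases i <;> rfl

theorem sum_upd4 (φ : AlternatingMap ℝ (Fin 7 → ℝ) ℝ (Fin 4)) (A : (Fin 7 → ℝ) →ₗ[ℝ] (Fin 7 → ℝ))
    (v : Fin 4 → Fin 7 → ℝ) :
    -∑ i, φ (Function.update v i (A (v i))) = -(φ ![A (v 0), v 1, v 2, v 3]
      + φ ![v 0, A (v 1), v 2, v 3] + φ ![v 0, v 1, A (v 2), v 3] + φ ![v 0, v 1, v 2, A (v 3)]) := by
  rw [Fin.sum_univ_four]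
  congr 5 <;> congr 1 <;> ext i : 1 <;> fin_cases i <;> rfl

theorem end_p1 (x : Fin 7 → ℝ) :
    twoFormEnd ϖ₁ x = ![-1 * x 1, 1 * x 0, -1 * x 3, 1 * x 2, 0, 0, 0] := by
  ext i
  fin_cases i <;> simp [twoFormEnd, ϖ₁, eform_two, Matrix.mulVec, dotProduct, Fin.sum_univ_succ,
    Pi.single_apply]

theorem end_p2 (x : Fin 7 → ℝ) :
    twoFormEnd ϖ₂ x = ![-1 * x 2, 1 * x 3, 1 * x 0, -1 * x 1, 0, 0, 0] := by
  ext i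
  fin_cases i <;> simp [twoFormEnd, ϖ₂, eform_two, Matrix.mulVec, dotProduct, Fin.sum_univ_succ,
    Pi.single_apply]

theorem end_p3 (x : Fin 7 → ℝ) :
    twoFormEnd ϖ₃ x = ![-1 * x 3, -1 * x 2, 1 * x 1, 1 * x 0, 0, 0, 0] := by
  ext i
  fin_cases i <;> simp [twoFormEnd, ϖ₃, eform_two, Matrix.mulVec, dotProduct, Fin.sum_univ_succ,
    Pi.single_apply]

theorem end_k1 (x : Fin 7 → ℝ) :
    twoFormEnd κ₁ x = ![-1 * x 1, 1 * x 0, 1 * x 3, -1 * x 2, 0, 2 * x 6, -2 * x 5] := by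
  ext i
  fin_cases i <;> simp [twoFormEnd, κ₁, eform_two, Matrix.mulVec, dotProduct, Fin.sum_univ_succ,
    Pi.single_apply]

theorem end_k2 (x : Fin 7 → ℝ) :
    twoFormEnd κ₂ x = ![-1 * x 2, -1 * x 3, 1 * x 0, 1 * x 1, -2 * x 6, 0, 2 * x 4] := by
  ext i
  fin_cases i <;> simp [twoFormEnd, κ₂, eform_two, Matrix.mulVec, dotProduct, Fin.sum_univ_succ,
    Pi.single_apply]

theorem end_k3 (x : Fin 7 → ℝ) :
    twoFormEnd κ₃ x = ![-1 * x 3, 1 * x 2, -1 * x 1, 1 * x 0, 2 * x 5, -2 * x 4, 0] := by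
  ext i
  fin_cases i <;> simp [twoFormEnd, κ₃, eform_two, Matrix.mulVec, dotProduct, Fin.sum_univ_succ,
    Pi.single_apply]

set_option maxHeartbeats 4000000 in
theorem kill_p1_a (v : Fin 3 → (Fin 7 → ℝ)) :
    -∑ i, α (Function.update v i (twoFormEnd ϖ₁ (v i))) = 0 := by
  rw [sum_upd3]
  simp only [end_p1, α, AlternatingMap.add_apply, AlternatingMap.sub_apply, AlternatingMap.neg_apply,
    AlternatingMap.smul_apply, smul_eq_mul, eform_three, Matrix.cons_val]
  ring

set_option maxHeartbeats 4000000 in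
theorem kill_p1_b (v : Fin 4 → (Fin 7 → ℝ)) :
    -∑ i, β (Function.update v i (twoFormEnd ϖ₁ (v i))) = 0 := by
  rw [sum_upd4]
  simp only [end_p1, β, AlternatingMap.add_apply, AlternatingMap.sub_apply, AlternatingMap.neg_apply,
    AlternatingMap.smul_apply, smul_eq_mul, eform_four, Matrix.cons_val]
  ring

set_option maxHeartbeats 4000000 in
theorem kill_p2_a (v : Fin 3 → (Fin 7 → ℝ)) :
    -∑ i, α (Function.update v i (twoFormEnd ϖ₂ (v i))) = 0 := by
  rw [sum_upd3]
  simp only [end_p2, α, AlternatingMap.add_apply, AlternatingMap.sub_apply, AlternatingMap.neg_apply,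
    AlternatingMap.smul_apply, smul_eq_mul, eform_three, Matrix.cons_val]
  ring

set_option maxHeartbeats 4000000 in
theorem kill_p2_b (v : Fin 4 → (Fin 7 → ℝ)) :
    -∑ i, β (Function.update v i (twoFormEnd ϖ₂ (v i))) = 0 := by
  rw [sum_upd4]
  simp only [end_p2, β, AlternatingMap.add_apply, AlternatingMap.sub_apply, AlternatingMap.neg_apply,
    AlternatingMap.smul_apply, smul_eq_mul, eform_four, Matrix.cons_val]
  ring

set_option maxHeartbeats 4000000 in
theorem kill_p3_a (v : Fin 3 → (Fin 7 → ℝ)) :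
    -∑ i, α (Function.update v i (twoFormEnd ϖ₃ (v i))) = 0 := by
  rw [sum_upd3]
  simp only [end_p3, α, AlternatingMap.add_apply, AlternatingMap.sub_apply, AlternatingMap.neg_apply,
    AlternatingMap.smul_apply, smul_eq_mul, eform_three, Matrix.cons_val]
  ring

set_option maxHeartbeats 4000000 in
theorem kill_p3_b (v : Fin 4 → (Fin 7 → ℝ)) :
    -∑ i, β (Function.update v i (twoFormEnd ϖ₃ (v i))) = 0 := by
  rw [sum_upd4]
  simp only [end_p3, β, AlternatingMap.add_apply, AlternatingMap.sub_apply, AlternatingMap.neg_apply,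
    AlternatingMap.smul_apply, smul_eq_mul, eform_four, Matrix.cons_val]
  ring

set_option maxHeartbeats 4000000 in
theorem kill_k1_a (v : Fin 3 → (Fin 7 → ℝ)) :
    -∑ i, α (Function.update v i (twoFormEnd κ₁ (v i))) = 0 := by
  rw [sum_upd3]
  simp only [end_k1, α, AlternatingMap.add_apply, AlternatingMap.sub_apply, AlternatingMap.neg_apply,
    AlternatingMap.smul_apply, smul_eq_mul, eform_three, Matrix.cons_val]
  ring

set_option maxHeartbeats 4000000 in
theorem kill_k1_b (v : Fin 4 → (Fin 7 → ℝ)) :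
    -∑ i, β (Function.update v i (twoFormEnd κ₁ (v i))) = 0 := by
  rw [sum_upd4]
  simp only [end_k1, β, AlternatingMap.add_apply, AlternatingMap.sub_apply, AlternatingMap.neg_apply,
    AlternatingMap.smul_apply, smul_eq_mul, eform_four, Matrix.cons_val]
  ring

set_option maxHeartbeats 4000000 in
theorem kill_k2_a (v : Fin 3 → (Fin 7 → ℝ)) :
    -∑ i, α (Function.update v i (twoFormEnd κ₂ (v i))) = 0 := by
  rw [sum_upd3]
  simp only [end_k2, α, AlternatingMap.add_apply, AlternatingMap.sub_apply, AlternatingMap.neg_apply,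
    AlternatingMap.smul_apply, smul_eq_mul, eform_three, Matrix.cons_val]
  ring

set_option maxHeartbeats 4000000 in
theorem kill_k2_b (v : Fin 4 → (Fin 7 → ℝ)) :
    -∑ i, β (Function.update v i (twoFormEnd κ₂ (v i))) = 0 := by
  rw [sum_upd4]
  simp only [end_k2, β, AlternatingMap.add_apply, AlternatingMap.sub_apply, AlternatingMap.neg_apply,
    AlternatingMap.smul_apply, smul_eq_mul, eform_four, Matrix.cons_val]
  ring

set_option maxHeartbeats 4000000 in
theorem kill_k3_a (v : Fin 3 → (Fin 7 → ℝ)) :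
    -∑ i, α (Function.update v i (twoFormEnd κ₃ (v i))) = 0 := by
  rw [sum_upd3]
  simp only [end_k3, α, AlternatingMap.add_apply, AlternatingMap.sub_apply, AlternatingMap.neg_apply,
    AlternatingMap.smul_apply, smul_eq_mul, eform_three, Matrix.cons_val]
  ring

set_option maxHeartbeats 4000000 in
theorem kill_k3_b (v : Fin 4 → (Fin 7 → ℝ)) :
    -∑ i, β (Function.update v i (twoFormEnd κ₃ (v i))) = 0 := by
  rw [sum_upd4]
  simp only [end_k3, β, AlternatingMap.add_apply, AlternatingMap.sub_apply, AlternatingMap.neg_apply,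
    AlternatingMap.smul_apply, smul_eq_mul, eform_four, Matrix.cons_val]
  ring

/-- The derivation action `(A·φ)(v₁,…,v_k) = −∑ᵢ φ(v₁,…,A vᵢ,…,v_k)` of each of the six
2-forms kills `α` and `β`. -/
theorem so4_annihilates_alpha_beta :
    ∀ ω ∈ ({ϖ₁, ϖ₂, ϖ₃, κ₁, κ₂, κ₃} : Set (AlternatingMap ℝ (Fin 7 → ℝ) ℝ (Fin 2))),
      (∀ v : Fin 3 → (Fin 7 → ℝ),
        -∑ i, α (Function.update v i (twoFormEnd ω (v i))) = 0) ∧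
      (∀ v : Fin 4 → (Fin 7 → ℝ),
        -∑ i, β (Function.update v i (twoFormEnd ω (v i))) = 0) := by
  intro ω hω
  simp only [Set.mem_insert_iff, Set.mem_singleton_iff] at hω
  rcases hω with rfl | rfl | rfl | rfl | rfl | rfl
  · exact ⟨kill_p1_a, kill_p1_b⟩
  · exact ⟨kill_p2_a, kill_p2_b⟩
  · exact ⟨kill_p3_a, kill_p3_b⟩
  · exact ⟨kill_k1_a, kill_k1_b⟩
  · exact ⟨kill_k2_a, kill_k2_b⟩
  · exact ⟨kill_k3_a, kill_k3_b⟩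

end
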